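/- Let C_ω^n be an edge-weighted cycle on vertex set [n] (with arbitrary positive integer weights on its edges), and let I = I(C_ω^n) be its edge ideal. If I is integrally closed, then I is normal, i.e., I^k is integrally closed for every k ≥ 1. -/

import Mathlib

open MvPolynomial

/-- The edge ideal of an edge-weighted graph `G` with weight function `w`. -/
noncomputable def edgeIdeal (K : Type*) [Field K] {n : ℕ}
    (G : SimpleGraph (Fin n)) (w : Sym2 (Fin n) → ℕ) :
    Ideal (MvPolynomial (Fin n) K) :=
  Ideal.span {m | ∃ i j : Fin n, G.Adj i j ∧ m = X i ^ w s(i, j) * X j ^ w s(i, j)}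

/-- The integral closure of an ideal `I`. -/
def intClosure {R : Type*} [CommRing R] (I : Ideal R) : Set R :=
  {f | ∃ k : ℕ, 0 < k ∧ ∃ c : ℕ → R,
    (∀ i ∈ Finset.Icc 1 k, c i ∈ I ^ i) ∧
    f ^ k + ∑ i ∈ Finset.Icc 1 k, c i * f ^ (k - i) = 0}

/-- An ideal is integrally closed if it equals its integral closure. -/
def IsIntClosed {R : Type*} [CommRing R] (I : Ideal R) : Prop :=
  intClosure I = ↑I

/-- Difference rounding: a real point of a cyclic system with integer bounds on sums of neighbours,
vanishing at `0`, can be rounded to a natural point without decreasing the total. -/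
lemma exists_nat_round_of_zero {N : ℕ} (a : Fin (N + 2) → ℕ) (μ : Fin (N + 2) → ℝ)
    (h0 : ∀ v, 0 ≤ μ v) (hz : μ 0 = 0) (ha : ∀ v, μ v + μ (v + 1) ≤ a (v + 1)) :
    ∃ m : Fin (N + 2) → ℕ, (∀ v, m v + m (v + 1) ≤ a (v + 1)) ∧ (∀ v, μ v = 0 → m v = 0) ∧
      ∑ v, μ v ≤ ∑ v, (m v : ℝ) := by
  set T : ℕ → ℝ := fun i => ∑ j ∈ Finset.range i, μ (Fin.ofNat (N + 2) j) with hT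
  have hTs : ∀ i, T (i + 1) = T i + μ (Fin.ofNat (N + 2) i) := fun i => Finset.sum_range_succ _ _
  have hmono : ∀ i, T i ≤ T (i + 1) := fun i => by rw [hTs]; linarith [h0 (Fin.ofNat (N + 2) i)]
  have hofv : ∀ v : Fin (N + 2), Fin.ofNat (N + 2) v.val = v := fun v => by
    ext; simp
  have hcast : ∀ i, ((⌈T (i + 1)⌉ - ⌈T i⌉).toNat : ℤ) = ⌈T (i + 1)⌉ - ⌈T i⌉ := fun i =>
    Int.toNat_of_nonneg (sub_nonneg.2 (Int.ceil_mono (hmono i)))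
  have hdiff : ∀ (x y : ℝ) (b : ℕ), y ≤ x + b → ⌈y⌉ ≤ ⌈x⌉ + b := fun x y b h => by
    have := Int.ceil_mono h
    rwa [Int.ceil_add_natCast] at this
  have hm0 : ∀ v : Fin (N + 2), μ v = 0 → (⌈T (v.val + 1)⌉ - ⌈T v.val⌉).toNat = 0 := by
    intro v hv
    rw [hTs, hofv, hv]; simp
  refine ⟨fun v => (⌈T (v.val + 1)⌉ - ⌈T v.val⌉).toNat, ?_, hm0, ?_⟩
  · intro v
    zify
    rw [hcast, hcast]
    have hav := ha v
    by_cases hv : v.val + 1 < N + 2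
    · have hv1 : (v + 1).val = v.val + 1 := by
        rw [Fin.val_add, Fin.val_one, Nat.mod_eq_of_lt hv]
      have e1 := hTs v.val
      have e2 := hTs (v.val + 1)
      rw [hofv] at e1
      rw [← hv1, hofv, hv1] at e2
      have := hdiff (T v.val) (T (v.val + 1 + 1)) (a (v + 1)) (by linarith)
      rw [hv1]
      linarith
    · have hv1 : v + 1 = 0 := by
        ext
        have : v.val + 1 = N + 2 := by omega
        rw [Fin.val_add, Fin.val_one, this]; simp
      rw [hv1] at hav ⊢
      have e1 := hTs v.val
      rw [hofv] at e1
      have := hdiff (T v.val) (T (v.val + 1)) (a 0) (by linarith)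
      have e0 : T (0 + 1) = T 0 := by
        rw [hTs]
        have := hofv 0
        simp only [Fin.val_zero] at this
        rw [this, hz, add_zero]
      simp only [Fin.val_zero, e0]
      linarith
  · have h1 : ∑ v, μ v = T (N + 2) := by
      rw [hT]
      simp only
      rw [← Fin.sum_univ_eq_sum_range (fun j => μ (Fin.ofNat (N + 2) j))]
      simp only [hofv]
    have h2 : ∑ v : Fin (N + 2), (((⌈T (v.val + 1)⌉ - ⌈T v.val⌉).toNat : ℕ) : ℤ) = ⌈T (N + 2)⌉ := by
      simp only [hcast]
      rw [Fin.sum_univ_eq_sum_range (fun j => ⌈T (j + 1)⌉ - ⌈T j⌉),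
        Finset.sum_range_sub (fun j => ⌈T j⌉)]
      simp [hT]
    have h3 : ∑ v : Fin (N + 2), (((⌈T (v.val + 1)⌉ - ⌈T v.val⌉).toNat : ℕ) : ℝ)
        = (⌈T (N + 2)⌉ : ℝ) := by exact_mod_cast congrArg (Int.cast : ℤ → ℝ) h2
    rw [h1, h3]
    exact Int.le_ceil _

lemma exists_nat_round {N : ℕ} (a : Fin (N + 2) → ℕ) (μ : Fin (N + 2) → ℝ) (h : Fin (N + 2))
    (h0 : ∀ v, 0 ≤ μ v) (hz : μ h = 0) (ha : ∀ v, μ v + μ (v + 1) ≤ a (v + 1)) :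
    ∃ m : Fin (N + 2) → ℕ, (∀ v, m v + m (v + 1) ≤ a (v + 1)) ∧ (∀ v, μ v = 0 → m v = 0) ∧
      ∑ v, μ v ≤ ∑ v, (m v : ℝ) := by
  obtain ⟨m, h1, h2, h3⟩ := exists_nat_round_of_zero (fun v => a (h + v)) (fun v => μ (h + v))
    (fun v => h0 _) (by simpa using hz) (fun v => by simpa [add_assoc] using ha (h + v))
  refine ⟨fun v => m (v - h), fun v => ?_, fun v hv => ?_, ?_⟩
  · have := h1 (v - h)
    rwa [show v - h + 1 = v + 1 - h by abel, show h + (v + 1 - h) = v + 1 by abel] at this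
  · exact h2 _ (by rwa [add_sub_cancel])
  · rw [← Equiv.sum_comp (Equiv.addLeft h) μ,
      ← Equiv.sum_comp (Equiv.addLeft h) (fun v => (m (v - h) : ℝ))]
    simpa using h3

lemma exists_nat_round_weighted_of_lt_one {N : ℕ} (W a : Fin (N + 3) → ℕ) (l : Fin (N + 3) → ℝ)
    (hW : ∀ v, 1 ≤ W v)
    (H : ∀ i j, i ≠ j → 2 ≤ W i → 2 ≤ W j →
      (j = i + 2 ∧ W (i + 1) = 1) ∨ (i = j + 2 ∧ W (j + 1) = 1))
    (h0 : ∀ v, 0 ≤ l v) (hlt : ∀ v, l v < 1)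
    (ha : ∀ v, W v * l v + W (v + 1) * l (v + 1) ≤ a (v + 1)) :
    ∃ m : Fin (N + 3) → ℕ, (∀ v, W v * m v + W (v + 1) * m (v + 1) ≤ a (v + 1)) ∧
      ∑ v, l v < ∑ v, (m v : ℝ) + 1 := by
  have t2 : (2 : Fin (N + 3)) = 1 + 1 := by
    ext; simp [Fin.val_add]
  have n1 : (1 : Fin (N + 3)) ≠ 0 := by simp
  have n2 : (1 + 1 : Fin (N + 3)) ≠ 0 := by
    rw [← t2]; intro h; have := congrArg Fin.val h; simp at this
    rw [Nat.mod_eq_of_lt (by omega)] at this; omega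
  set A : Fin (N + 3) → ℝ := fun v => W v * l v with hA
  have hWr : ∀ v, (1 : ℝ) ≤ W v := fun v => by exact_mod_cast hW v
  have hlA : ∀ v, l v ≤ A v := fun v => by
    have := mul_le_mul_of_nonneg_right (hWr v) (h0 v); simpa [hA] using this
  have hA0 : ∀ v, 0 ≤ A v := fun v => (h0 v).trans (hlA v)
  obtain ⟨h, -, hmax⟩ := Finset.exists_max_image Finset.univ
    (fun v => if 2 ≤ W v then A v else -1) ⟨0, Finset.mem_univ _⟩
  have hmax' : ∀ v, 2 ≤ W v → 2 ≤ W h ∧ A v ≤ A h := by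
    intro v hv
    have := hmax v (Finset.mem_univ _)
    have h1 := hA0 v
    simp only [hv, if_true] at this
    split_ifs at this with h2
    · exact ⟨h2, this⟩
    · linarith
  clear hmax
  set base : Fin (N + 3) → ℝ := fun v => if 2 ≤ W v ∨ v = h then 0 else l v with hbase
  set q₁ : ℝ := if W (h + 1) = 1 ∧ 2 ≤ W (h + 2) then A (h + 2) else 0 with hq₁
  set q₂ : ℝ := if W (h - 1) = 1 ∧ 2 ≤ W (h - 2) then A (h - 2) else 0 with hq₂
  set μ : Fin (N + 3) → ℝ := fun v =>
    base v + (if v = h + 1 then q₁ else 0) + (if v = h - 1 then q₂ else 0) with hμ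
  have q10 : 0 ≤ q₁ := by rw [hq₁]; split_ifs <;> [exact hA0 _; exact le_rfl]
  have q20 : 0 ≤ q₂ := by rw [hq₂]; split_ifs <;> [exact hA0 _; exact le_rfl]
  have base0 : ∀ v, 0 ≤ base v := fun v => by
    simp only [hbase]; split_ifs <;> [exact le_rfl; exact h0 _]
  have baseA : ∀ v, base v ≤ A v := fun v => by
    simp only [hbase]; split_ifs <;> [exact hA0 _; exact hlA _]
  have q1A : q₁ ≤ A h := by
    rw [hq₁]; split_ifs with c <;> [exact (hmax' _ c.2).2; exact hA0 _]
  have q2A : q₂ ≤ A h := by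
    rw [hq₂]; split_ifs with c <;> [exact (hmax' _ c.2).2; exact hA0 _]
  have hμ0 : ∀ v, 0 ≤ μ v := fun v => by
    simp only [hμ]
    have := base0 v
    split_ifs <;> linarith
  have hp : h ≠ h + 1 := by simp
  have hm : h ≠ h - 1 := by
    intro e; rw [eq_sub_iff_add_eq] at e; exact hp e.symm
  have hpm : h + 1 ≠ h - 1 := by
    intro e; rw [eq_sub_iff_add_eq, add_assoc] at e; exact n2 (by simpa using e)
  have hμh : μ h = 0 := by simp [hμ, hbase, hp, hm]
  have hμW : ∀ v, 2 ≤ W v → μ v = 0 := by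
    intro v hv
    simp only [hμ, hbase, hv, true_or, if_true, zero_add]
    have e1 : (if v = h + 1 then q₁ else 0) = 0 := by
      split_ifs with c
      · rw [hq₁, if_neg]; rintro ⟨c1, -⟩; rw [c] at hv; omega
      · rfl
    have e2 : (if v = h - 1 then q₂ else 0) = 0 := by
      split_ifs with c
      · rw [hq₂, if_neg]; rintro ⟨c1, -⟩; rw [c] at hv; omega
      · rfl
    rw [e1, e2, add_zero]
  have hμp : μ (h + 1) = base (h + 1) + q₁ := by simp [hμ, hpm]
  have hμm : μ (h - 1) = base (h - 1) + q₂ := by simp [hμ, hpm.symm]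
  have hμo : ∀ v, v ≠ h + 1 → v ≠ h - 1 → μ v ≤ A v := fun v c1 c2 => by
    simp only [hμ, c1, c2, if_false, add_zero]; exact baseA v
  have hfeas : ∀ v, μ v + μ (v + 1) ≤ A v + A (v + 1) := by
    intro v
    by_cases c1 : v = h
    · subst c1
      rw [hμh, hμp]; linarith [baseA (v + 1)]
    by_cases c2 : v + 1 = h
    · have : v = h - 1 := by rw [← c2]; abel
      rw [c2, hμh, this, hμm]; linarith [baseA (h - 1)]
    by_cases c3 : v = h + 1
    · subst c3
      by_cases d : 2 ≤ W (h + 1 + 1)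
      · have : q₁ ≤ A (h + 1 + 1) := by
          rw [hq₁, t2, ← add_assoc]; split_ifs <;> [exact le_rfl; exact hA0 _]
        rw [hμW _ d, hμp]; linarith [baseA (h + 1)]
      · have hq : q₁ = 0 := by rw [hq₁, if_neg]; rw [t2, ← add_assoc]; tauto
        by_cases e : h + 1 + 1 = h - 1
        · have e' : h - 2 = h + 1 := by rw [t2, ← sub_sub, ← e]; abel
          by_cases d' : 2 ≤ W (h + 1)
          · rw [hμW _ d', e, hμm]
            have : q₂ ≤ A (h + 1) := by
              rw [hq₂, e']; split_ifs <;> [exact le_rfl; exact hA0 _]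
            linarith [baseA (h - 1)]
          · have hq' : q₂ = 0 := by rw [hq₂, if_neg]; rw [e']; tauto
            rw [e, hμp, hμm, hq, hq']; linarith [baseA (h - 1), baseA (h + 1)]
        · have := hμo (h + 1 + 1) (by simp) e
          rw [hμp, hq]; linarith [baseA (h + 1)]
    by_cases c4 : v + 1 = h - 1
    · have e' : h - 2 = v := by rw [t2, ← sub_sub, ← c4]; abel
      by_cases d : 2 ≤ W v
      · have : q₂ ≤ A v := by
          rw [hq₂, e']; split_ifs <;> [exact le_rfl; exact hA0 _]
        rw [hμW _ d, c4, hμm]; linarith [baseA (h - 1)]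
      · have hq : q₂ = 0 := by rw [hq₂, if_neg]; rw [e']; tauto
        have : μ v ≤ A v := by
          refine hμo v c3 ?_
          rintro e
          rw [← c4] at e
          simp at e
        rw [c4, hμm, hq]; linarith [baseA (h - 1)]
    · have c5 : v ≠ h - 1 := fun e => c2 (by rw [e]; abel)
      have c6 : v + 1 ≠ h + 1 := fun e => c1 (by simpa using e)
      linarith [hμo v c3 c5, hμo (v + 1) c6 c4]
  obtain ⟨m, hm1, hm2, hm3⟩ := exists_nat_round a μ h hμ0 hμh
    (fun v => (hfeas v).trans (ha v))
  have hWm : ∀ v, W v * m v = m v := by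
    intro v
    by_cases c : 2 ≤ W v
    · simp [hm2 v (hμW v c)]
    · rw [show W v = 1 by have := hW v; omega, one_mul]
  refine ⟨m, fun v => by rw [hWm, hWm]; exact hm1 v, ?_⟩
  have hpt : ∀ v, l v ≤ base v + (if v = h then l h else 0) + (if v = h + 2 then q₁ else 0)
      + (if v = h - 2 then q₂ else 0) := by
    intro v
    by_cases c : v = h
    · subst c
      have := base0 v
      simp only [if_true]
      split_ifs <;> linarith
    by_cases d : 2 ≤ W v
    · rcases H h v (Ne.symm c) (hmax' v d).1 d with ⟨e1, e2⟩ | ⟨e1, e2⟩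
      · have : q₁ = A v := by rw [hq₁, ← e1, if_pos ⟨e2, d⟩]
        have h3 := hlA v
        have := base0 v
        rw [if_pos e1, if_neg c]
        split_ifs <;> linarith
      · have e3 : v = h - 2 := by rw [e1]; abel
        have e4 : v + 1 = h - 1 := by rw [e1, t2]; abel
        rw [e4] at e2
        have : q₂ = A v := by rw [hq₂, ← e3, if_pos ⟨e2, d⟩]
        have h3 := hlA v
        have := base0 v
        rw [if_pos e3, if_neg c]
        split_ifs <;> linarith
    · have : base v = l v := by simp [hbase, c, d]
      rw [this, if_neg c]
      split_ifs <;> linarith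
  have hs := Finset.sum_le_sum (fun v (_ : v ∈ Finset.univ) => hpt v)
  have hs2 : ∑ v, μ v = ∑ v, base v + q₁ + q₂ := by
    simp [hμ, Finset.sum_add_distrib]
  simp only [Finset.sum_add_distrib, Finset.sum_ite_eq', Finset.mem_univ, if_true] at hs
  linarith [hlt h]

/-- The rounding property of an edge-weighted cycle in which any two edges of weight at least `2`
are joined by an edge of weight `1`; edge `v` has end points `v` and `v + 1`. -/
lemma exists_nat_round_weighted {N k : ℕ} (W a : Fin (N + 3) → ℕ) (l : Fin (N + 3) → ℝ)
    (hW : ∀ v, 1 ≤ W v)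
    (H : ∀ i j, i ≠ j → 2 ≤ W i → 2 ≤ W j →
      (j = i + 2 ∧ W (i + 1) = 1) ∨ (i = j + 2 ∧ W (j + 1) = 1))
    (h0 : ∀ v, 0 ≤ l v) (hk : ∑ v, l v = k)
    (ha : ∀ v, W v * l v + W (v + 1) * l (v + 1) ≤ a (v + 1)) :
    ∃ m : Fin (N + 3) → ℕ, (∀ v, W v * m v + W (v + 1) * m (v + 1) ≤ a (v + 1)) ∧
      k ≤ ∑ v, m v := by
  have hfl : ∀ v, (⌊l v⌋₊ : ℝ) ≤ l v := fun v => Nat.floor_le (h0 v)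
  have hsub : ∀ v, W v * ⌊l v⌋₊ + W (v + 1) * ⌊l (v + 1)⌋₊ ≤ a (v + 1) := by
    intro v
    have h1 := mul_le_mul_of_nonneg_left (hfl v) (Nat.cast_nonneg (α := ℝ) (W v))
    have h2 := mul_le_mul_of_nonneg_left (hfl (v + 1)) (Nat.cast_nonneg (α := ℝ) (W (v + 1)))
    have := ha v
    have : (W v * ⌊l v⌋₊ + W (v + 1) * ⌊l (v + 1)⌋₊ : ℝ) ≤ a (v + 1) := by linarith
    exact_mod_cast this
  obtain ⟨m, hm1, hm2⟩ := exists_nat_round_weighted_of_lt_one W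
    (fun v => a v - (W (v - 1) * ⌊l (v - 1)⌋₊ + W v * ⌊l v⌋₊)) (fun v => l v - ⌊l v⌋₊) hW H
    (fun v => sub_nonneg.2 (hfl v)) (fun v => by linarith [Nat.lt_floor_add_one (l v)])
    (fun v => by
      rw [add_sub_cancel_right, Nat.cast_sub (hsub v)]
      push_cast
      linarith [ha v])
  refine ⟨fun v => m v + ⌊l v⌋₊, fun v => ?_, ?_⟩
  · have h1 := hm1 v
    have h2 := hsub v
    simp only [add_sub_cancel_right] at h1
    simp only [mul_add]
    omega
  · rw [Finset.sum_sub_distrib, hk] at hm2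
    rw [Finset.sum_add_distrib, ← Nat.lt_add_one_iff]
    have : (k : ℝ) < (∑ v, m v + ∑ v, ⌊l v⌋₊ + 1 : ℕ) := by push_cast; linarith
    exact_mod_cast this

section Order

variable {σ R : Type*} [CommRing R]

lemma forall_mem_support_mul {f g : MvPolynomial σ R} {p q r : (σ →₀ ℕ) → Prop}
    (hf : ∀ x ∈ f.support, p x) (hg : ∀ x ∈ g.support, q x)
    (h : ∀ x y, p x → q y → r (x + y)) : ∀ x ∈ (f * g).support, r x := by
  classical
  intro z hz
  obtain ⟨x, hx, y, hy, rfl⟩ := Finset.mem_add.1 (support_mul f g hz)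
  exact h x y (hf x hx) (hg y hy)

lemma forall_mem_support_add {f g : MvPolynomial σ R} {p : (σ →₀ ℕ) → Prop}
    (hf : ∀ x ∈ f.support, p x) (hg : ∀ x ∈ g.support, p x) : ∀ x ∈ (f + g).support, p x := by
  classical
  intro z hz
  exact (Finset.mem_union.1 (support_add hz)).elim (hf z) (hg z)

lemma forall_mem_support_sum {ι : Type*} {s : Finset ι} {f : ι → MvPolynomial σ R}
    {p : (σ →₀ ℕ) → Prop} (hf : ∀ i ∈ s, ∀ x ∈ (f i).support, p x) :
    ∀ x ∈ (∑ i ∈ s, f i).support, p x := by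
  classical
  intro z hz
  obtain ⟨i, hi, hz⟩ := Finset.mem_biUnion.1 (support_sum hz)
  exact hf i hi z hz

lemma forall_mem_support_pow (L : (σ →₀ ℕ) →+ ℝ) {c : ℝ} {f : MvPolynomial σ R}
    (hf : ∀ x ∈ f.support, c ≤ L x) (m : ℕ) : ∀ x ∈ (f ^ m).support, m * c ≤ L x := by
  classical
  induction m with
  | zero =>
    intro x hx
    rw [pow_zero] at hx
    have : x = 0 := by
      by_contra h
      rw [mem_support_iff, coeff_one, if_neg (Ne.symm h)] at hx
      exact hx rfl
    simp [this]
  | succ m ih =>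
    rw [pow_succ]
    refine forall_mem_support_mul ih hf fun x y hx hy => ?_
    rw [map_add]; push_cast; linarith

lemma forall_mem_support_of_mem_span (L : (σ →₀ ℕ) →+ ℝ) (hL : ∀ x, 0 ≤ L x) {c : ℝ}
    {s : Set (σ →₀ ℕ)} (hs : ∀ x ∈ s, c ≤ L x) {f : MvPolynomial σ R}
    (hf : f ∈ Ideal.span ((fun s => monomial s (1 : R)) '' s)) : ∀ x ∈ f.support, c ≤ L x := by
  intro x hx
  obtain ⟨y, hy, hyx⟩ := mem_ideal_span_monomial_image.1 hf x hx
  obtain ⟨z, rfl⟩ := exists_add_of_le hyx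
  rw [map_add]
  linarith [hs y hy, hL z]

lemma forall_mem_support_of_mem_pow (L : (σ →₀ ℕ) →+ ℝ) (hL : ∀ x, 0 ≤ L x) {c : ℝ}
    {I : Ideal (MvPolynomial σ R)} (hI : ∀ f ∈ I, ∀ x ∈ f.support, c ≤ L x) (k : ℕ) :
    ∀ f ∈ I ^ k, ∀ x ∈ f.support, k * c ≤ L x := by
  induction k with
  | zero => intro f _ x _; simpa using hL x
  | succ k ih =>
    intro f hf
    rw [pow_succ] at hf
    refine Submodule.mul_induction_on hf (fun a ha b hb => ?_)
      (fun a b ha hb => forall_mem_support_add ha hb)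
    refine forall_mem_support_mul (ih a ha) (hI b hb) fun x y hx hy => ?_
    rw [map_add]; push_cast; linarith

/-- A monomial valuation which is at least `c` on an ideal is at least `c` on every element
integral over the ideal. -/
lemma forall_mem_support_of_mem_intClosure [IsDomain R] (L : (σ →₀ ℕ) →+ ℝ) (hL : ∀ x, 0 ≤ L x)
    {c : ℝ} {I : Ideal (MvPolynomial σ R)} (hI : ∀ f ∈ I, ∀ x ∈ f.support, c ≤ L x)
    {f : MvPolynomial σ R} (hf : f ∈ intClosure I) : ∀ x ∈ f.support, c ≤ L x := by
  classical
  intro x hx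
  by_contra! hxc
  obtain ⟨k, hk, a, ha, heq⟩ := hf
  obtain ⟨x₀, hx₀, hmin⟩ := Finset.exists_min_image f.support L ⟨x, hx⟩
  have hμc : L x₀ < c := (hmin x hx).trans_lt hxc
  set f₀ : MvPolynomial σ R := ∑ y ∈ f.support with L y = L x₀, monomial y (coeff y f) with hf₀
  set f₁ : MvPolynomial σ R := ∑ y ∈ f.support with ¬ L y = L x₀, monomial y (coeff y f) with hf₁
  have hsplit : f = f₀ + f₁ := by
    rw [hf₀, hf₁, Finset.sum_filter_add_sum_filter_not, support_sum_monomial_coeff]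
  have hs₀ : ∀ y ∈ f₀.support, L y = L x₀ := by
    refine forall_mem_support_sum fun y hy z hz => ?_
    rw [Finset.mem_singleton.1 (support_monomial_subset hz)]
    exact (Finset.mem_filter.1 hy).2
  have hs₁ : ∀ y ∈ f₁.support, L x₀ < L y := by
    refine forall_mem_support_sum fun y hy z hz => ?_
    rw [Finset.mem_singleton.1 (support_monomial_subset hz)]
    have := Finset.mem_filter.1 hy
    exact lt_of_le_of_ne (hmin y this.1) (Ne.symm this.2)
  have hne : f₀ ≠ 0 := by
    intro h
    rw [h, zero_add] at hsplit
    rw [hsplit] at hx₀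
    exact lt_irrefl _ (hs₁ x₀ hx₀)
  have hpow : ∀ m : ℕ, ∀ y ∈ (f ^ m - f₀ ^ m).support, m * L x₀ < L y := by
    intro m
    induction m with
    | zero => simp
    | succ m ih =>
      have : f ^ (m + 1) - f₀ ^ (m + 1) = (f ^ m - f₀ ^ m) * f₀ + f ^ m * f₁ := by
        rw [show f₁ = f - f₀ by rw [hsplit]; ring]; ring
      rw [this]
      refine forall_mem_support_add
        (forall_mem_support_mul ih hs₀ fun y z hy hz => ?_)
        (forall_mem_support_mul (forall_mem_support_pow L hmin m) hs₁ fun y z hy hz => ?_) <;>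
      · rw [map_add]; push_cast; linarith
  have hsum : ∀ y ∈ (∑ i ∈ Finset.Icc 1 k, a i * f ^ (k - i)).support, k * L x₀ < L y := by
    refine forall_mem_support_sum fun i hi => ?_
    refine forall_mem_support_mul (forall_mem_support_of_mem_pow L hL hI i _ (ha i hi))
      (forall_mem_support_pow L hmin (k - i)) fun y z hy hz => ?_
    obtain ⟨h1, h2⟩ := Finset.mem_Icc.1 hi
    rw [Nat.cast_sub h2] at hz
    have : (0 : ℝ) < i := by exact_mod_cast h1
    rw [map_add]
    nlinarith
  have hk₀ : -(f₀ ^ k) = (f ^ k - f₀ ^ k) + ∑ i ∈ Finset.Icc 1 k, a i * f ^ (k - i) := by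
    linear_combination -heq
  obtain ⟨y, hy⟩ := Finset.nonempty_iff_ne_empty.2
    (fun h => neg_ne_zero.2 (pow_ne_zero k hne) (support_eq_empty.1 h))
  have h1 : k * L x₀ < L y := forall_mem_support_add (hpow k) hsum y (hk₀ ▸ hy)
  rw [support_neg] at hy
  have h2 := forall_mem_support_pow (-L) (c := -L x₀)
    (fun z hz => by simp [hs₀ z hz]) k y hy
  rw [AddMonoidHom.neg_apply] at h2
  linarith

/-- The Newton polyhedron bound: exponents of elements integral over the `k`-th power of a monomial
ideal dominate `k` times a convex combination of exponents of generators. -/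
lemma exists_weights_of_mem_intClosure_pow [IsDomain R] [Fintype σ] {ι : Type*} [Fintype ι]
    [Nonempty ι] (E : ι → σ →₀ ℕ) (k : ℕ) {f : MvPolynomial σ R}
    (hf : f ∈ intClosure (Ideal.span ((fun s => monomial s (1 : R)) '' Set.range E) ^ k))
    {x : σ →₀ ℕ} (hx : x ∈ f.support) :
    ∃ l : ι → ℝ, (∀ i, 0 ≤ l i) ∧ ∑ i, l i = k ∧ ∀ v, ∑ i, l i * E i v ≤ x v := by
  classical
  by_contra! hno
  let Φ : (ι → ℝ) →ₗ[ℝ] (σ → ℝ) :=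
    { toFun := fun l v => ∑ i, (k * l i) * E i v
      map_add' := fun a b => by
        ext v; simp [← Finset.sum_add_distrib, mul_add, add_mul]
      map_smul' := fun c a => by
        ext v; simp only [Pi.smul_apply, smul_eq_mul, RingHom.id_apply, Finset.mul_sum]
        exact Finset.sum_congr rfl fun i _ => by ring }
  have hdisj : Disjoint (Φ '' stdSimplex ℝ ι) (Set.Iic fun v => (x v : ℝ)) := by
    rw [Set.disjoint_left]
    rintro _ ⟨l, hl, rfl⟩ hle
    obtain ⟨v, hv⟩ := hno (fun i => k * l i) (fun i => mul_nonneg (Nat.cast_nonneg _) (hl.1 i))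
      (by rw [← Finset.mul_sum, hl.2, mul_one])
    exact absurd (hle v) (not_le.2 hv)
  obtain ⟨φ, u, t, hu, hut, ht⟩ := geometric_hahn_banach_compact_closed
    ((convex_stdSimplex ℝ ι).linear_image Φ)
    ((isCompact_stdSimplex ℝ ι).image Φ.continuous_of_finiteDimensional)
    (convex_Iic _) isClosed_Iic hdisj
  have hφ : ∀ y : σ → ℝ, φ y = ∑ v, y v * φ (Pi.single v 1) := by
    intro y
    conv_lhs => rw [pi_eq_sum_univ' y]
    simp [map_sum]
  let L : (σ →₀ ℕ) →+ ℝ :=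
    { toFun := fun y => -φ (fun v => (y v : ℝ))
      map_zero' := by
        rw [hφ]; simp
      map_add' := fun a b => by
        rw [hφ, hφ (fun v => (a v : ℝ)), hφ (fun v => (b v : ℝ))]
        simp [add_mul, Finset.sum_add_distrib]; ring }
  have hneg : ∀ v, φ (Pi.single v 1) ≤ 0 := by
    intro v
    by_contra! hpos
    obtain ⟨c, hc⟩ := exists_nat_gt ((φ (fun v => (x v : ℝ)) - t) / φ (Pi.single v 1))
    rw [div_lt_iff₀ hpos] at hc
    have := ht ((fun v => (x v : ℝ)) - (c : ℝ) • Pi.single v 1) (by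
      intro z
      by_cases h : z = v
      · subst h; simp
      · simp [h])
    rw [map_sub, map_smul, smul_eq_mul] at this
    linarith
  have hL : ∀ y, 0 ≤ L y := by
    intro y
    change 0 ≤ -φ _
    rw [hφ, neg_nonneg]
    exact Finset.sum_nonpos fun v _ => mul_nonpos_of_nonneg_of_nonpos (Nat.cast_nonneg _) (hneg v)
  obtain ⟨i₀, -, hi₀⟩ := Finset.exists_min_image Finset.univ (fun i => L (E i))
    Finset.univ_nonempty
  have hge : k * L (E i₀) ≤ L x := forall_mem_support_of_mem_intClosure L hL
    (forall_mem_support_of_mem_pow L hL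
      (fun g hg => forall_mem_support_of_mem_span L hL
        (by rintro _ ⟨i, rfl⟩; exact hi₀ i (Finset.mem_univ _)) hg) k) hf x hx
  have h1 := hu (Φ (Pi.single i₀ 1)) ⟨_, single_mem_stdSimplex ℝ i₀, rfl⟩
  have h2 := ht (fun v => (x v : ℝ)) (Set.mem_Iic.2 le_rfl)
  have h3 : Φ (Pi.single i₀ 1) = (k : ℝ) • fun v => (E i₀ v : ℝ) := by
    ext v
    simp [Φ, Pi.single_apply]
  rw [h3, map_smul, smul_eq_mul] at h1
  change k * -φ (fun v => (E i₀ v : ℝ)) ≤ -φ (fun v => (x v : ℝ)) at hge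
  linarith

lemma monomial_mem_span_pow {ι : Type*} [Fintype ι] (E : ι → σ →₀ ℕ) {k : ℕ} {x : σ →₀ ℕ}
    (m : ι → ℕ) (hk : k ≤ ∑ i, m i) (hx : ∀ v, ∑ i, m i * E i v ≤ x v) (c : R) :
    monomial x c ∈ Ideal.span ((fun s => monomial s (1 : R)) '' Set.range E) ^ k := by
  classical
  refine Ideal.pow_le_pow_right hk ?_
  have hle : ∑ i, m i • E i ≤ x := fun v => by
    simpa [Finsupp.finsetSum_apply] using hx v
  obtain ⟨z, rfl⟩ := exists_add_of_le hle
  have : monomial (∑ i, m i • E i + z) c = (∏ i, monomial (E i) (1 : R) ^ m i) * monomial z c := by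
    simp only [monomial_pow, one_pow]
    rw [← monomial_sum_one, monomial_mul, one_mul]
  rw [this, ← Finset.prod_pow_eq_pow_sum]
  refine Ideal.mul_mem_right _ _ (Ideal.prod_mem_prod fun i _ => Ideal.pow_mem_pow ?_ _)
  exact Ideal.subset_span ⟨_, ⟨i, rfl⟩, rfl⟩

lemma subset_intClosure (I : Ideal R) : (I : Set R) ⊆ intClosure I := fun f hf =>
  ⟨1, one_pos, fun _ => -f, by simpa using hf, by simp⟩

end Order

/-- The exponent of the generator of the edge ideal of a cycle given by the edge `{v, v + 1}`. -/
noncomputable def cycleExponent {N : ℕ} (W : Fin (N + 3) → ℕ) (v : Fin (N + 3)) :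
    Fin (N + 3) →₀ ℕ :=
  Finsupp.single v (W v) + Finsupp.single (v + 1) (W v)

lemma cycleExponent_apply {N : ℕ} (W : Fin (N + 3) → ℕ) (i v : Fin (N + 3)) :
    cycleExponent W i v = (if i = v then W i else 0) + (if i + 1 = v then W i else 0) := by
  simp [cycleExponent, Finsupp.single_apply]

lemma fin_add_one_add_one_ne {N : ℕ} (a : Fin (N + 3)) : a + 1 + 1 ≠ a := by
  have t2 : (1 + 1 : Fin (N + 3)) = 2 := by
    ext; simp [Fin.val_add]
  rw [add_assoc, t2, Ne, add_eq_left]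
  intro h
  have := congrArg Fin.val h
  simp at this
  rw [Nat.mod_eq_of_lt (by omega)] at this; omega

lemma edgeIdeal_cycle_eq_span (K : Type*) [Field K] {N : ℕ} (G : SimpleGraph (Fin (N + 3)))
    (w : Sym2 (Fin (N + 3)) → ℕ) (hG : ∀ i j, G.Adj i j ↔ i + 1 = j ∨ j + 1 = i) :
    edgeIdeal K G w = Ideal.span ((fun s => monomial s (1 : K)) ''
      Set.range (cycleExponent fun v => w s(v, v + 1))) := by
  have key : ∀ v, monomial (cycleExponent (fun v => w s(v, v + 1)) v) (1 : K)
      = X v ^ w s(v, v + 1) * X (v + 1) ^ w s(v, v + 1) := by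
    intro v
    rw [X_pow_eq_monomial, X_pow_eq_monomial, monomial_mul, one_mul, cycleExponent]
  rw [edgeIdeal, ← Set.range_comp]
  congr 1
  ext p
  constructor
  · rintro ⟨i, j, hij, rfl⟩
    rcases (hG i j).1 hij with rfl | rfl
    · exact ⟨i, key i⟩
    · exact ⟨j, (key j).trans (by rw [mul_comm, Sym2.eq_swap])⟩
  · rintro ⟨v, rfl⟩
    exact ⟨v, v + 1, (hG _ _).2 (Or.inl rfl), key v⟩

/-- In an integrally closed monomial ideal, the rounded up geometric mean of two generators is
divisible by a generator. -/
lemma exists_two_mul_le_of_isIntClosed {σ ι R : Type*} [CommRing R] [Nontrivial R] [Finite σ]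
    [Fintype ι] (E : ι → σ →₀ ℕ)
    (h : IsIntClosed (Ideal.span ((fun s => monomial s (1 : R)) '' Set.range E))) {i j : ι} :
    ∃ g, ∀ v, 2 * E g v ≤ E i v + E j v + 1 := by
  classical
  set u : σ →₀ ℕ := Finsupp.equivFunOnFinite.symm fun v => (E i v + E j v + 1) / 2 with hu
  have hmem : monomial u (1 : R) ∈
      intClosure (Ideal.span ((fun s => monomial s (1 : R)) '' Set.range E)) := by
    refine ⟨2, two_pos, fun t => if t = 2 then -(monomial u 1 ^ 2) else 0, ?_, ?_⟩
    · intro t _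
      by_cases ht : t = 2
      · subst ht
        simp only [if_true]
        rw [neg_mem_iff, monomial_pow, one_pow]
        refine monomial_mem_span_pow E (Pi.single i 1 + Pi.single j 1) ?_ (fun v => ?_) 1
        · simp [Finset.sum_add_distrib]
        · simp only [Pi.add_apply, add_mul, Finset.sum_add_distrib, Pi.single_apply, ite_mul,
            one_mul, zero_mul, Finset.sum_ite_eq', Finset.mem_univ, if_true, Finsupp.smul_apply,
            smul_eq_mul, hu, Finsupp.equivFunOnFinite_symm_apply_apply]
          omega
      · simp [ht]
    · simp
  rw [h] at hmem
  obtain ⟨_, ⟨g, rfl⟩, hg⟩ := mem_ideal_span_monomial_image.1 hmem u (by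
    simp [mem_support_iff])
  refine ⟨g, fun v => ?_⟩
  have := hg v
  simp only [hu, Finsupp.equivFunOnFinite_symm_apply_apply] at this
  omega

lemma cycle_joined_by_smaller {N : ℕ} (W : Fin (N + 3) → ℕ) (hW : ∀ v, 1 ≤ W v)
    {i j : Fin (N + 3)} (hij : i ≠ j) (hi : 2 ≤ W i) (hj : 2 ≤ W j)
    (h : ∃ g, ∀ v, 2 * cycleExponent W g v ≤ cycleExponent W i v + cycleExponent W j v + 1) :
    (j = i + 1 + 1 ∧ W (i + 1) < W i ∧ W (i + 1) < W j) ∨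
      (i = j + 1 + 1 ∧ W (j + 1) < W i ∧ W (j + 1) < W j) := by
  obtain ⟨g, hg⟩ := h
  simp only [cycleExponent_apply] at hg
  have n1 : ∀ a : Fin (N + 3), a + 1 ≠ a := fun a => by simp
  have n2 := fin_add_one_add_one_ne (N := N)
  have inj : ∀ a b : Fin (N + 3), a + 1 = b + 1 → a = b := fun a b => by simp
  have h1 := hg g
  have h2 := hg (g + 1)
  have h3 := hW g
  clear hg
  grind

lemma cycle_joined_by_one {N : ℕ} (W : Fin (N + 3) → ℕ) (hW : ∀ v, 1 ≤ W v)
    (h : ∀ i j, ∃ g, ∀ v,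
      2 * cycleExponent W g v ≤ cycleExponent W i v + cycleExponent W j v + 1)
    (i j : Fin (N + 3)) (hij : i ≠ j) (hi : 2 ≤ W i) (hj : 2 ≤ W j) :
    (j = i + 2 ∧ W (i + 1) = 1) ∨ (i = j + 2 ∧ W (j + 1) = 1) := by
  have t2 : (2 : Fin (N + 3)) = 1 + 1 := by
    ext; simp [Fin.val_add]
  rw [t2, ← add_assoc, ← add_assoc]
  have n1 : ∀ a : Fin (N + 3), a ≠ a + 1 := fun a => by simp
  have inj : ∀ a b : Fin (N + 3), a + 1 = b + 1 → a = b := fun a b => by simp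
  have key : ∀ i j : Fin (N + 3), 2 ≤ W i → 2 ≤ W j → j = i + 1 + 1 → W (i + 1) < W i →
      W (i + 1) < W j → W (i + 1) = 1 := by
    intro i j hi hj e h1 h2
    by_contra hne
    have h3 : 2 ≤ W (i + 1) := by have := hW (i + 1); omega
    rcases cycle_joined_by_smaller W hW (n1 i) hi h3 (h _ _) with ⟨c, -⟩ | ⟨-, -, c⟩
    · exact n1 _ (inj _ _ c)
    · rw [← e] at c; omega
  rcases cycle_joined_by_smaller W hW hij hi hj (h i j) with ⟨e, h1, h2⟩ | ⟨e, h1, h2⟩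
  · exact Or.inl ⟨e, key i j hi hj e h1 h2⟩
  · exact Or.inr ⟨e, key j i hj hi e h2 h1⟩

lemma sum_mul_cycleExponent {N : ℕ} {S : Type*} [CommSemiring S] (W : Fin (N + 3) → ℕ)
    (m : Fin (N + 3) → S) (v : Fin (N + 3)) :
    ∑ i, m i * (cycleExponent W i (v + 1) : S) = W v * m v + W (v + 1) * m (v + 1) := by
  simp [cycleExponent_apply, mul_add, Finset.sum_add_distrib, mul_comm, add_comm]

/-- Let `C_ω^n` be an edge-weighted cycle on `[n]` with arbitrary positive integer
weights. If its edge ideal is integrally closed, then it is normal: every power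
`I^k`, `k ≥ 1`, is integrally closed. -/
theorem edgeIdeal_cycle_normal_of_intClosed
    (K : Type*) [Field K] {n : ℕ} (hn : 3 ≤ n)
    (G : SimpleGraph (Fin n)) (w : Sym2 (Fin n) → ℕ)
    (hG : ∀ i j : Fin n, G.Adj i j ↔
      ((i.val + 1) % n = j.val ∨ (j.val + 1) % n = i.val))
    (hw : ∀ e ∈ G.edgeSet, 1 ≤ w e)
    (hic : IsIntClosed (edgeIdeal K G w)) :
    ∀ k : ℕ, 1 ≤ k → IsIntClosed (edgeIdeal K G w ^ k) := by
  intro k _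
  obtain ⟨N, rfl⟩ : ∃ N, n = N + 3 := ⟨n - 3, by omega⟩
  have hG' : ∀ i j, G.Adj i j ↔ i + 1 = j ∨ j + 1 = i := fun i j => by
    rw [hG, Fin.ext_iff, Fin.ext_iff, Fin.val_add, Fin.val_add, Fin.val_one]
  set W : Fin (N + 3) → ℕ := fun v => w s(v, v + 1)
  have hW : ∀ v, 1 ≤ W v := fun v =>
    hw _ ((SimpleGraph.mem_edgeSet G).2 ((hG' _ _).2 (Or.inl rfl)))
  rw [edgeIdeal_cycle_eq_span K G w hG'] at hic ⊢
  have H := cycle_joined_by_one W hW fun i j => exists_two_mul_le_of_isIntClosed _ hic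
  refine Set.Subset.antisymm (fun f hf => ?_) (subset_intClosure _)
  rw [← support_sum_monomial_coeff f]
  refine Ideal.sum_mem _ fun x hx => ?_
  obtain ⟨l, h0, hsum, hle⟩ := exists_weights_of_mem_intClosure_pow _ k hf hx
  obtain ⟨m, hm, hmk⟩ := exists_nat_round_weighted W x l hW H h0 hsum fun v => by
    rw [← sum_mul_cycleExponent]; exact hle (v + 1)
  refine monomial_mem_span_pow _ m hmk (fun v => ?_) _
  have := hm (v - 1)
  rw [sub_add_cancel] at this
  have h2 := sum_mul_cycleExponent W m (v - 1)
  rw [sub_add_cancel] at h2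
  simp only [Nat.cast_id] at h2
  exact h2.trans_le this
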